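/- Assume the standard setup, and suppose in addition that G has exactly k ≥ 1 pendant vertices and χ_la(G) = k + 1 = t, so that V_r is the unique color class containing no pendant vertex. Assume e + s·n_r ≥ c_{r−1} (this condition is vacuous when r = 1), where s ≥ 1 if n_r = 1 and s ≥ 2 is even if n_r ≥ 2. Then G(V_r,s) has s·n_r + k pendant vertices and χ_la(G(V_r,s)) = s·n_r + k + 1. -/

import Mathlib

open Finset
open scoped Classical

namespace LocalAntimagic

variable {V : Type*}

/-- The induced vertex label: sum of the labels of edges incident to `v`. -/
noncomputable def vertexSum [Fintype V] (G : SimpleGraph V) (f : Sym2 V → ℕ) (v : V) : ℕ :=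
  ∑ e ∈ G.incidenceFinset v, f e

/-- `f` is a local antimagic labeling of `G`: a bijection from the edge set onto
`{1, …, |E|}` whose induced vertex labels distinguish adjacent vertices. -/
def IsLocalAntimagic [Fintype V] (G : SimpleGraph V) (f : Sym2 V → ℕ) : Prop :=
  Set.BijOn f G.edgeSet (Set.Icc 1 G.edgeFinset.card) ∧
  ∀ ⦃u v : V⦄, G.Adj u v → vertexSum G f u ≠ vertexSum G f v

/-- The color number `c(f)`: the number of distinct induced vertex labels. -/
noncomputable def colorCount [Fintype V] (G : SimpleGraph V) (f : Sym2 V → ℕ) : ℕ :=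
  (Finset.univ.image (vertexSum G f)).card

/-- The local antimagic chromatic number. -/
noncomputable def chiLA [Fintype V] (G : SimpleGraph V) : ℕ :=
  sInf {n | ∃ f, IsLocalAntimagic G f ∧ colorCount G f = n}

/-- A pendant vertex is a vertex of degree 1. -/
def IsPendant [Fintype V] (G : SimpleGraph V) (v : V) : Prop :=
  G.degree v = 1

/-- The number of pendant vertices of `G`. -/
noncomputable def pendantCount [Fintype V] (G : SimpleGraph V) : ℕ :=
  (Finset.univ.filter (fun v => IsPendant G v)).card

/-- `G(S, s)`: the graph obtained from `G` by attaching `s` new pendant edges to every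
vertex of `S`.  The new pendant vertex attached to `w ∈ S` via the `j`-th new edge is
`Sum.inr (w, j)`; the original graph lives on the `Sum.inl` vertices. -/
def attachPendants (G : SimpleGraph V) (S : Finset V) (s : ℕ) :
    SimpleGraph (V ⊕ (S × Fin s)) :=
  SimpleGraph.fromRel (fun a b =>
    (∃ u v : V, a = Sum.inl u ∧ b = Sum.inl v ∧ G.Adj u v) ∨
    (∃ (w : S) (j : Fin s), a = Sum.inl (w : V) ∧ b = Sum.inr (w, j)))

/-- The standard setup: `G` is a connected graph with at least `2` edges and
`χ_la(G) = t ≥ 2`; `f` is a local antimagic labeling of `G` with `c(f) = t` whose color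
classes are `Vset 1, …, Vset t` (each nonempty, with `f⁺ ≡ c i` on `Vset i`, and the
colors `c 1, …, c t` pairwise distinct); every non-pendant vertex lies in
`Vset 1 ∪ ⋯ ∪ Vset r` where `1 ≤ r ≤ t`; each `Vset i` with `r + 1 ≤ i ≤ t` is a
singleton consisting of a pendant vertex; `c 1 < c 2 < ⋯ < c r` and
`c (r+1) < c (r+2) < ⋯ < c t`. -/
structure StandardSetup [Fintype V] (G : SimpleGraph V) (f : Sym2 V → ℕ)
    (t r : ℕ) (Vset : ℕ → Finset V) (c : ℕ → ℕ) : Prop where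
  connected : G.Connected
  two_le_card_edges : 2 ≤ G.edgeFinset.card
  chiLA_eq : chiLA G = t
  two_le_t : 2 ≤ t
  antimagic : IsLocalAntimagic G f
  colorCount_eq : colorCount G f = t
  color_on_class : ∀ i ∈ Finset.Icc 1 t, ∀ v ∈ Vset i, vertexSum G f v = c i
  class_cover : ∀ v : V, ∃ i ∈ Finset.Icc 1 t, v ∈ Vset i
  class_nonempty : ∀ i ∈ Finset.Icc 1 t, (Vset i).Nonempty
  color_injective : ∀ i ∈ Finset.Icc 1 t, ∀ j ∈ Finset.Icc 1 t, i ≠ j → c i ≠ c j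
  one_le_r : 1 ≤ r
  r_le_t : r ≤ t
  nonpendant_mem : ∀ v : V, ¬ IsPendant G v → ∃ i ∈ Finset.Icc 1 r, v ∈ Vset i
  pendant_singleton : ∀ i ∈ Finset.Icc (r + 1) t, ∃ v : V, IsPendant G v ∧ Vset i = {v}
  c_strictMono_low : ∀ i j : ℕ, 1 ≤ i → i < j → j ≤ r → c i < c j
  c_strictMono_high : ∀ i j : ℕ, r + 1 ≤ i → i < j → j ≤ t → c i < c j

/-- `b`: the number of pendant vertices of `G` lying in `Vset 1 ∪ ⋯ ∪ Vset r`. -/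
noncomputable def pendantsInLow [Fintype V] (G : SimpleGraph V)
    (Vset : ℕ → Finset V) (r : ℕ) : ℕ :=
  (((Finset.Icc 1 r).biUnion Vset).filter (fun v => IsPendant G v)).card

theorem vertexSum_eq_sum_ite [Fintype V] (G : SimpleGraph V) (f : Sym2 V → ℕ) (v : V) :
    vertexSum G f v = ∑ w, if G.Adj v w then f s(v, w) else 0 := by
  rw [← Finset.sum_filter]
  unfold vertexSum
  symm
  refine Finset.sum_bij (fun w _ => s(v, w)) ?_ ?_ ?_ ?_
  · intro w hw
    simpa [SimpleGraph.mem_incidenceFinset, SimpleGraph.mk'_mem_incidenceSet_iff] using hw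
  · intro a _ b _ h
    exact Sym2.congr_right.1 h
  · intro x hx
    rw [SimpleGraph.mem_incidenceFinset] at hx
    obtain ⟨w, rfl⟩ := Sym2.mem_iff_exists.1 hx.2
    exact ⟨w, by simpa using hx.1, rfl⟩
  · intros
    rfl

theorem le_vertexSum [Fintype V] (G : SimpleGraph V) (f : Sym2 V → ℕ) {v w : V}
    (h : G.Adj v w) : f s(v, w) ≤ vertexSum G f v := by
  rw [vertexSum_eq_sum_ite]
  have := Finset.single_le_sum (f := fun w => if G.Adj v w then f s(v, w) else 0)
    (fun _ _ => Nat.zero_le _) (Finset.mem_univ w)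
  simpa [h] using this

theorem add_le_vertexSum [Fintype V] (G : SimpleGraph V) (f : Sym2 V → ℕ) {v w x : V}
    (hw : G.Adj v w) (hx : G.Adj v x) (hwx : w ≠ x) :
    f s(v, w) + f s(v, x) ≤ vertexSum G f v := by
  rw [vertexSum_eq_sum_ite]
  have := Finset.sum_le_sum_of_subset (f := fun w => if G.Adj v w then f s(v, w) else 0)
    (Finset.subset_univ {w, x})
  simpa [Finset.sum_pair hwx, hw, hx] using this

theorem IsPendant.exists_vertexSum_eq [Fintype V] {G : SimpleGraph V} {v : V}
    (h : IsPendant G v) (f : Sym2 V → ℕ) : ∃ w, G.Adj v w ∧ vertexSum G f v = f s(v, w) := by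
  obtain ⟨w, hw, huniq⟩ := SimpleGraph.degree_eq_one_iff_existsUnique_adj.1 h
  refine ⟨w, hw, ?_⟩
  rw [vertexSum_eq_sum_ite, Finset.sum_eq_single w]
  · simp [hw]
  · intro b _ hb
    exact if_neg fun hab => hb (huniq b hab)
  · simp

theorem exists_adj_ne_of_not_isPendant [Fintype V] {G : SimpleGraph V} {v w : V}
    (h : ¬ IsPendant G v) (hw : G.Adj v w) : ∃ x, G.Adj v x ∧ w ≠ x := by
  by_contra! hcon
  exact h (SimpleGraph.degree_eq_one_iff_existsUnique_adj.2
    ⟨w, hw, fun y hy => (hcon y hy).symm⟩)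

/-- The pendant vertices receive distinct colors, none of them exceeding the number of edges, and
the edge with the largest label has an endpoint whose color exceeds the number of edges. -/
theorem pendantCount_lt_colorCount [Fintype V] {G : SimpleGraph V} {f : Sym2 V → ℕ}
    (hf : IsLocalAntimagic G f) (hG : 0 < G.edgeFinset.card) :
    pendantCount G < colorCount G f := by
  obtain ⟨⟨hmaps, hinj, hsurj⟩, hadj⟩ := hf
  have hpos {a b : V} (h : G.Adj a b) : 1 ≤ f s(a, b) ∧ f s(a, b) ≤ G.edgeFinset.card :=
    hmaps (show s(a, b) ∈ G.edgeSet from h)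
  have hbig : ∃ u, G.edgeFinset.card < vertexSum G f u := by
    obtain ⟨x, hx, hfx⟩ := hsurj (show G.edgeFinset.card ∈ Set.Icc 1 G.edgeFinset.card from
      ⟨hG, le_rfl⟩)
    induction x using Sym2.ind with
    | h a b =>
      have key {a b : V} (hab : G.Adj a b) (hl : f s(a, b) = G.edgeFinset.card)
          (ha : ¬ IsPendant G a) : ∃ u, G.edgeFinset.card < vertexSum G f u := by
        obtain ⟨y, hy, hne⟩ := exists_adj_ne_of_not_isPendant ha hab
        have h1 := add_le_vertexSum G f hab hy hne
        have h2 := hpos hy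
        exact ⟨a, by omega⟩
      have hab : G.Adj a b := hx
      by_cases ha : IsPendant G a
      · by_cases hb : IsPendant G b
        · obtain ⟨x, hx, hx'⟩ := ha.exists_vertexSum_eq f
          obtain ⟨y, hy, hy'⟩ := hb.exists_vertexSum_eq f
          have h1 := le_vertexSum G f hab
          have h2 := le_vertexSum G f hab.symm
          rw [Sym2.eq_swap] at h2
          have h3 := hpos hx
          have h4 := hpos hy
          exact absurd (by omega) (hadj hab)
        · exact key hab.symm (by rw [Sym2.eq_swap, hfx]) hb
      · exact key hab hfx ha
  obtain ⟨u, hu⟩ := hbig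
  have hinj' : Set.InjOn (vertexSum G f)
      (Finset.univ.filter (fun v => IsPendant G v) : Finset V) := by
    intro a ha b hb hab
    have ha' : IsPendant G a := by simpa using ha
    have hb' : IsPendant G b := by simpa using hb
    obtain ⟨x, hx, hx'⟩ := ha'.exists_vertexSum_eq f
    obtain ⟨y, hy, hy'⟩ := hb'.exists_vertexSum_eq f
    have hxy : s(a, x) = s(b, y) := hinj hx hy (by omega)
    rcases Sym2.eq_iff.1 hxy with ⟨h, _⟩ | ⟨_, h⟩
    · exact h
    · subst h
      exact absurd hab (hadj hx)
  unfold pendantCount colorCount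
  rw [← Finset.card_image_of_injOn hinj']
  refine Finset.card_lt_card ((Finset.ssubset_iff_of_subset
    (Finset.image_subset_image (Finset.subset_univ _))).2
      ⟨vertexSum G f u, Finset.mem_image_of_mem _ (Finset.mem_univ u), fun hmem => ?_⟩)
  obtain ⟨v, hv, hvu⟩ := Finset.mem_image.1 hmem
  have hv' : IsPendant G v := by simpa using hv
  obtain ⟨x, hx, hx'⟩ := hv'.exists_vertexSum_eq f
  have := hpos hx
  omega

theorem vertexSum_eq_degree [Fintype V] {G : SimpleGraph V} {f : Sym2 V → ℕ}
    (hf : ∀ x ∈ G.edgeSet, f x = 1) (v : V) : vertexSum G f v = G.degree v := by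
  unfold vertexSum
  rw [Finset.sum_congr rfl fun x hx => hf x ((G.mem_incidenceFinset v x).1 hx).1]
  simp

section AttachPendants

variable (G : SimpleGraph V) (S : Finset V) (s : ℕ)

@[simp]
theorem attachPendants_adj_inl_inl (u v : V) :
    (attachPendants G S s).Adj (Sum.inl u) (Sum.inl v) ↔ G.Adj u v := by
  simp only [attachPendants, SimpleGraph.fromRel_adj]
  constructor
  · rintro ⟨-, (⟨a, b, h1, h2, h⟩ | ⟨w, j, h1, h2⟩) | ⟨a, b, h1, h2, h⟩ | ⟨w, j, h1, h2⟩⟩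
    · cases h1; cases h2; exact h
    · cases h2
    · cases h1; cases h2; exact h.symm
    · cases h2
  · intro h
    exact ⟨fun h' => h.ne (Sum.inl.inj h'), Or.inl (Or.inl ⟨u, v, rfl, rfl, h⟩)⟩

@[simp]
theorem attachPendants_adj_inl_inr (u : V) (p : S × Fin s) :
    (attachPendants G S s).Adj (Sum.inl u) (Sum.inr p) ↔ u = p.1 := by
  simp only [attachPendants, SimpleGraph.fromRel_adj]
  constructor
  · rintro ⟨-, (⟨a, b, h1, h2, h⟩ | ⟨w, j, h1, h2⟩) | ⟨a, b, h1, h2, h⟩ | ⟨w, j, h1, h2⟩⟩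
    · cases h2
    · cases h1; cases h2; rfl
    · cases h1
    · cases h1
  · rintro rfl
    exact ⟨Sum.inl_ne_inr, Or.inl (Or.inr ⟨p.1, p.2, rfl, rfl⟩)⟩

@[simp]
theorem attachPendants_adj_inr_inl (u : V) (p : S × Fin s) :
    (attachPendants G S s).Adj (Sum.inr p) (Sum.inl u) ↔ u = p.1 := by
  rw [SimpleGraph.adj_comm, attachPendants_adj_inl_inr]

@[simp]
theorem not_attachPendants_adj_inr_inr (p q : S × Fin s) :
    ¬ (attachPendants G S s).Adj (Sum.inr p) (Sum.inr q) := by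
  simp [attachPendants, SimpleGraph.fromRel_adj]

variable {S s}

/-- The edge labeling of `attachPendants G S s` given by `f` on the edges of `G` and by `g` on the
new pendant edges. -/
def extendLabel (f : Sym2 V → ℕ) (g : S × Fin s → ℕ) : Sym2 (V ⊕ (S × Fin s)) → ℕ :=
  Sym2.lift ⟨fun a b => match a, b with
    | .inl u, .inl v => f s(u, v)
    | .inl _, .inr p => g p
    | .inr p, .inl _ => g p
    | .inr p, .inr q => g p + g q, by
      rintro (a | a) (b | b)
      · exact congrArg f Sym2.eq_swap
      · rfl
      · rfl
      · exact add_comm _ _⟩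

variable (f : Sym2 V → ℕ) (g : S × Fin s → ℕ)

theorem vertexSum_attachPendants_inr [Fintype V] (p : S × Fin s) :
    vertexSum (attachPendants G S s) (extendLabel f g) (Sum.inr p) = g p := by
  rw [vertexSum_eq_sum_ite, Fintype.sum_sum_type]
  simp [extendLabel]

theorem vertexSum_attachPendants_inl_mem [Fintype V] (w : S) :
    vertexSum (attachPendants G S s) (extendLabel f g) (Sum.inl (w : V)) =
      vertexSum G f w + ∑ j, g (w, j) := by
  rw [vertexSum_eq_sum_ite, vertexSum_eq_sum_ite, Fintype.sum_sum_type, Fintype.sum_prod_type]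
  congr 1
  · simp [extendLabel]
  · rw [Finset.sum_eq_single w]
    · simp [extendLabel]
    · intro b _ hb
      refine Finset.sum_eq_zero fun j _ => if_neg fun h => hb (Subtype.ext ?_)
      exact ((attachPendants_adj_inl_inr G S s w (b, j)).1 h).symm
    · simp

theorem vertexSum_attachPendants_inl_notMem [Fintype V] {v : V} (hv : v ∉ S) :
    vertexSum (attachPendants G S s) (extendLabel f g) (Sum.inl v) = vertexSum G f v := by
  rw [vertexSum_eq_sum_ite, vertexSum_eq_sum_ite, Fintype.sum_sum_type]
  have h (p : S × Fin s) : v ≠ p.1 := fun h => hv (h ▸ p.1.2)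
  simp [extendLabel, h]

theorem extendLabel_one_eq_one (x : Sym2 (V ⊕ (S × Fin s)))
    (hx : x ∈ (attachPendants G S s).edgeSet) :
    extendLabel (fun _ => 1) (fun _ => 1) x = 1 := by
  induction x using Sym2.ind with
  | h a b =>
    rcases a with a | a <;> rcases b with b | b
    · rfl
    · rfl
    · rfl
    · exact absurd hx (not_attachPendants_adj_inr_inr G S s a b)

theorem degree_attachPendants_inr [Fintype V] (p : S × Fin s) :
    (attachPendants G S s).degree (Sum.inr p) = 1 := by
  rw [← vertexSum_eq_degree (extendLabel_one_eq_one G), vertexSum_attachPendants_inr]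

theorem degree_attachPendants_inl_mem [Fintype V] (w : S) :
    (attachPendants G S s).degree (Sum.inl (w : V)) = G.degree (w : V) + s := by
  rw [← vertexSum_eq_degree (extendLabel_one_eq_one G), vertexSum_attachPendants_inl_mem,
    vertexSum_eq_degree fun _ _ => rfl]
  simp

theorem degree_attachPendants_inl_notMem [Fintype V] {v : V} (hv : v ∉ S) :
    (attachPendants G S s).degree (Sum.inl v) = G.degree v := by
  rw [← vertexSum_eq_degree (extendLabel_one_eq_one G),
    vertexSum_attachPendants_inl_notMem _ _ _ hv, vertexSum_eq_degree fun _ _ => rfl]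

variable (S s) in
theorem card_edgeFinset_attachPendants [Fintype V] :
    (attachPendants G S s).edgeFinset.card = G.edgeFinset.card + s * S.card := by
  have h1 := (attachPendants G S s).sum_degrees_eq_twice_card_edges
  have h2 := G.sum_degrees_eq_twice_card_edges
  have h3 (v : V) : (attachPendants G S s).degree (Sum.inl v) =
      G.degree v + if v ∈ S then s else 0 := by
    by_cases hv : v ∈ S
    · rw [if_pos hv]
      exact degree_attachPendants_inl_mem G ⟨v, hv⟩
    · rw [if_neg hv, degree_attachPendants_inl_notMem G hv, add_zero]
  rw [Fintype.sum_sum_type] at h1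
  simp only [h3, degree_attachPendants_inr, Finset.sum_add_distrib, h2] at h1
  simp at h1
  rw [mul_comm S.card s] at h1
  omega

theorem pendantCount_attachPendants [Fintype V] (hs : 1 ≤ s) (hdeg : ∀ v ∈ S, 2 ≤ G.degree v) :
    pendantCount (attachPendants G S s) = s * S.card + pendantCount G := by
  have h (v : V) : IsPendant (attachPendants G S s) (Sum.inl v) ↔ IsPendant G v := by
    unfold IsPendant
    by_cases hv : v ∈ S
    · have h1 := degree_attachPendants_inl_mem (s := s) G ⟨v, hv⟩
      have h2 := hdeg v hv
      simp only at h1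
      omega
    · rw [degree_attachPendants_inl_notMem G hv]
  unfold pendantCount
  simp only [Finset.card_filter, Fintype.sum_sum_type, h]
  simp [IsPendant, degree_attachPendants_inr, mul_comm, add_comm]

variable {f g} in
theorem bijOn_extendLabel {e : ℕ} (hf : Set.BijOn f G.edgeSet (Set.Icc 1 e))
    (hg : Set.BijOn g Set.univ (Set.Icc (e + 1) (e + s * S.card))) :
    Set.BijOn (extendLabel f g) (attachPendants G S s).edgeSet (Set.Icc 1 (e + s * S.card)) := by
  have hedge : ∀ x ∈ (attachPendants G S s).edgeSet,
      (∃ y ∈ G.edgeSet, x = y.map Sum.inl ∧ extendLabel f g x = f y) ∨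
      ∃ p : S × Fin s, x = s(Sum.inl (p.1 : V), Sum.inr p) ∧ extendLabel f g x = g p := by
    intro x hx
    induction x using Sym2.ind with
    | h a b =>
      rw [SimpleGraph.mem_edgeSet] at hx
      rcases a with a | a <;> rcases b with b | b
      · exact Or.inl ⟨s(a, b), by simpa using hx, rfl, rfl⟩
      · rw [attachPendants_adj_inl_inr] at hx
        exact Or.inr ⟨b, by rw [hx], rfl⟩
      · rw [attachPendants_adj_inr_inl] at hx
        exact Or.inr ⟨a, by rw [hx, Sym2.eq_swap], rfl⟩
      · exact absurd hx (not_attachPendants_adj_inr_inr G S s a b)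
  have hf' {y} (hy : y ∈ G.edgeSet) : 1 ≤ f y ∧ f y ≤ e := hf.mapsTo hy
  have hg' (p) : e + 1 ≤ g p ∧ g p ≤ e + s * S.card := hg.mapsTo (Set.mem_univ p)
  refine ⟨fun x hx => ?_, fun x hx x' hx' heq => ?_, fun m hm => ?_⟩
  · rw [Set.mem_Icc]
    rcases hedge x hx with ⟨y, hy, -, h⟩ | ⟨p, -, h⟩
    · have := hf' hy
      omega
    · have := hg' p
      omega
  · rcases hedge x hx with ⟨y, hy, hxy, h⟩ | ⟨p, hxp, h⟩ <;>
      rcases hedge x' hx' with ⟨y', hy', hxy', h'⟩ | ⟨p', hxp', h'⟩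
    · rw [hxy, hxy', hf.injOn hy hy' (by omega)]
    · have := hf' hy
      have := hg' p'
      omega
    · have := hf' hy'
      have := hg' p
      omega
    · rw [hxp, hxp', hg.injOn (Set.mem_univ p) (Set.mem_univ p') (by omega)]
  · rw [Set.mem_Icc] at hm
    rcases le_or_gt m e with h | h
    · obtain ⟨y, hy, rfl⟩ := hf.surjOn (show m ∈ Set.Icc 1 e from ⟨hm.1, h⟩)
      induction y using Sym2.ind with
      | h a b => exact ⟨s(Sum.inl a, Sum.inl b), by simpa using hy, rfl⟩
    · obtain ⟨p, -, rfl⟩ := hg.surjOn (show m ∈ Set.Icc (e + 1) (e + s * S.card) from ⟨h, hm.2⟩)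
      exact ⟨s(Sum.inl (p.1 : V), Sum.inr p), by simp, rfl⟩

end AttachPendants

/-- Consecutive integers can be arranged in an array with `s` columns and constant row sums when
`s` is even or there is just one row. -/
theorem exists_bijOn_Icc_const_sum {α : Type*} [Fintype α] (e s : ℕ)
    (h : Fintype.card α ≤ 1 ∨ Even s) :
    ∃ g : α × Fin s → ℕ, Set.BijOn g Set.univ (Set.Icc (e + 1) (e + s * Fintype.card α)) ∧
      ∀ a b, ∑ j, g (a, j) = ∑ j, g (b, j) := by
  set n := Fintype.card α with hn
  let φ : α ≃ Fin n := Fintype.equivFin α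
  let ψ (a : α) (j : ℕ) : ℕ := if Even j then (φ a : ℕ) else n - 1 - φ a
  have hψ (a j) : ψ a j < n := by
    have := (φ a).2
    simp only [ψ]
    split_ifs <;> omega
  have hψ' (a b j) (hab : ψ a j = ψ b j) : a = b := by
    have h1 := (φ a).2
    have h2 := (φ b).2
    refine φ.injective (Fin.ext ?_)
    simp only [ψ] at hab
    split_ifs at hab <;> omega
  let g (p : α × Fin s) : ℕ := e + 1 + (ψ p.1 p.2 + n * p.2)
  have hmaps : Set.MapsTo g Set.univ (Set.Icc (e + 1) (e + s * n)) := by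
    rintro ⟨a, j⟩ -
    have h1 := hψ a j
    have h2 : n * (j + 1) ≤ n * s := Nat.mul_le_mul_left n j.2
    rw [mul_comm n s, mul_add] at h2
    simp only [Set.mem_Icc, g]
    omega
  have hinj : Function.Injective g := by
    rintro ⟨a, i⟩ ⟨b, j⟩ hab
    have hab' : ψ a i + n * i = ψ b j + n * j := by simpa [g] using hab
    have hdiv : (i : ℕ) = j := by
      have hn0 : 0 < n := (Nat.zero_le _).trans_lt (hψ a i)
      have := congrArg (· / n) hab'
      simpa [Nat.add_mul_div_left _ _ hn0, Nat.div_eq_of_lt (hψ _ _)] using this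
    obtain rfl := Fin.ext hdiv
    rw [hψ' a b i (by omega)]
  have hsurj : Set.SurjOn g Set.univ (Set.Icc (e + 1) (e + s * n)) := by
    have himage : Finset.univ.image g = Finset.Icc (e + 1) (e + s * n) := by
      refine Finset.eq_of_subset_of_card_le ?_ ?_
      · intro m hm
        obtain ⟨p, -, rfl⟩ := Finset.mem_image.1 hm
        exact Finset.mem_Icc.2 (hmaps (Set.mem_univ p))
      · rw [Finset.card_image_of_injective _ hinj]
        simp [← hn, mul_comm]
    intro m hm
    have hm' : m ∈ Finset.univ.image g := himage ▸ Finset.mem_Icc.2 hm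
    simpa using hm'
  refine ⟨g, ⟨hmaps, hinj.injOn, hsurj⟩, fun a b => ?_⟩
  rcases h with h | ⟨m, rfl⟩
  · rw [Fintype.card_le_one_iff.1 h a b]
  · have hsum (N : ℕ) : ∑ j ∈ Finset.range (N + N), ψ a j = ∑ j ∈ Finset.range (N + N), ψ b j := by
      induction N with
      | zero => rfl
      | succ N ih =>
        have h1 := (φ a).2
        have h2 := (φ b).2
        rw [show N + 1 + (N + 1) = N + N + 1 + 1 by ring]
        simp only [Finset.sum_range_succ, ih]
        simp only [ψ, Nat.even_add_one, Even.add_self, not_true_eq_false, if_true, if_false]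
        omega
    simp only [g, Finset.sum_add_distrib]
    rw [Fin.sum_univ_eq_sum_range (ψ a), Fin.sum_univ_eq_sum_range (ψ b), hsum m]

/-- Corollary 2.5, case `i = r`: in the standard setup, if `G` has
exactly `k ≥ 1` pendant vertices and `χ_la(G) = k + 1 = t`, so that `V_r` is the unique
color class containing no pendant vertex, and `e + s·n_r ≥ c_{r-1}` (vacuous when
`r = 1`), where `s ≥ 1` if `n_r = 1` and `s ≥ 2` is even if `n_r ≥ 2`, then
`G(V_r, s)` has `s·n_r + k` pendant vertices and `χ_la(G(V_r, s)) = s·n_r + k + 1`. -/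
theorem chiLA_attachPendants_nonpendant_class_of_pendant_graph [Fintype V]
    (G : SimpleGraph V) (f : Sym2 V → ℕ) (t r : ℕ) (Vset : ℕ → Finset V) (c : ℕ → ℕ)
    (setup : StandardSetup G f t r Vset c)
    (k : ℕ) (hk : 1 ≤ k) (hpend : pendantCount G = k) (ht : t = k + 1)
    (hVr : ∀ v ∈ Vset r, ¬ IsPendant G v)
    (hVr' : ∀ i ∈ Finset.Icc 1 t, i ≠ r → ∃ v ∈ Vset i, IsPendant G v)
    (e s : ℕ) (he : G.edgeFinset.card = e)
    (hbig : 2 ≤ r → c (r - 1) ≤ e + s * (Vset r).card)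
    (hs₁ : (Vset r).card = 1 → 1 ≤ s)
    (hs₂ : 2 ≤ (Vset r).card → 2 ≤ s ∧ Even s) :
    pendantCount (attachPendants G (Vset r) s) = s * (Vset r).card + k ∧
    chiLA (attachPendants G (Vset r) s) = s * (Vset r).card + k + 1 := by
  obtain ⟨v₀, hv₀⟩ := setup.class_nonempty r (Finset.mem_Icc.2 ⟨setup.one_le_r, setup.r_le_t⟩)
  have hr : r ∈ Finset.Icc 1 t := Finset.mem_Icc.2 ⟨setup.one_le_r, setup.r_le_t⟩
  have hcard : 1 ≤ (Vset r).card := Finset.card_pos.2 ⟨v₀, hv₀⟩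
  have hs : 1 ≤ s := by
    rcases hcard.eq_or_lt with h | h
    · exact hs₁ h.symm
    · exact one_le_two.trans (hs₂ h).1
  have hpar : Fintype.card (Vset r) ≤ 1 ∨ Even s := by
    rw [Fintype.card_coe]
    rcases hcard.eq_or_lt with h | h
    · exact Or.inl h.symm.le
    · exact Or.inr (hs₂ h).2
  obtain ⟨⟨hmaps, -, -⟩, hadj⟩ := setup.antimagic
  have hpos {a b : V} (h : G.Adj a b) : 1 ≤ f s(a, b) ∧ f s(a, b) ≤ e :=
    he ▸ hmaps (show s(a, b) ∈ G.edgeSet from h)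
  have hnontriv : Nontrivial V := by
    obtain ⟨x, hx⟩ := Finset.card_pos.1 (zero_lt_two.trans_le setup.two_le_card_edges)
    induction x using Sym2.ind with
    | h a b => exact ⟨a, b, G.ne_of_adj (by simpa using hx)⟩
  have hdegpos (v : V) : 0 < G.degree v := setup.connected.preconnected.degree_pos_of_nontrivial v
  have hdeg : ∀ v ∈ Vset r, 2 ≤ G.degree v := by
    intro v hv
    have h1 := hVr v hv
    have h2 := hdegpos v
    unfold IsPendant at h1
    omega
  have hpc : pendantCount (attachPendants G (Vset r) s) = s * (Vset r).card + k := by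
    rw [pendantCount_attachPendants G hs hdeg, hpend]
  refine ⟨hpc, ?_⟩
  have hci : ∀ i ∈ Finset.Icc 1 t, i ≠ r → c i ≤ e := by
    intro i hi hir
    obtain ⟨v, hv, hvp⟩ := hVr' i hi hir
    obtain ⟨w, hw, hvw⟩ := hvp.exists_vertexSum_eq f
    rw [← setup.color_on_class i hi v hv, hvw]
    exact (hpos hw).2
  have hcr (v : V) (hv : v ∈ Vset r) : vertexSum G f v = c r := setup.color_on_class r hr v hv
  have hcr_pos : 1 ≤ c r := by
    obtain ⟨w, hw⟩ := (G.degree_pos_iff_exists_adj v₀).1 (hdegpos v₀)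
    rw [← hcr v₀ hv₀]
    exact (hpos hw).1.trans (le_vertexSum G f hw)
  have hother (v : V) (hv : v ∉ Vset r) :
      ∃ i ∈ (Finset.Icc 1 t).erase r, vertexSum G f v = c i := by
    obtain ⟨i, hi, hvi⟩ := setup.class_cover v
    exact ⟨i, Finset.mem_erase.2 ⟨fun h => hv (h ▸ hvi), hi⟩, setup.color_on_class i hi v hvi⟩
  obtain ⟨g, hg, hsum⟩ := exists_bijOn_Icc_const_sum (α := Vset r) e s hpar
  rw [Fintype.card_coe] at hg
  have hg' (p) : e + 1 ≤ g p ∧ g p ≤ e + s * (Vset r).card := hg.mapsTo (Set.mem_univ p)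
  have hle (p : Vset r × Fin s) : g p ≤ ∑ j, g (p.1, j) :=
    Finset.single_le_sum (f := fun j => g (p.1, j)) (fun _ _ => Nat.zero_le _) (Finset.mem_univ p.2)
  let H := attachPendants G (Vset r) s
  let C := c r + ∑ j, g (⟨v₀, hv₀⟩, j)
  have hC (v : V) (hv : v ∈ Vset r) : vertexSum H (extendLabel f g) (Sum.inl v) = C := by
    rw [vertexSum_attachPendants_inl_mem G f g ⟨v, hv⟩, hcr v hv, hsum ⟨v, hv⟩ ⟨v₀, hv₀⟩]
  have hCg (p : Vset r × Fin s) : g p < C := by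
    have h1 := hle p
    rw [hsum p.1 ⟨v₀, hv₀⟩] at h1
    simp only [C]
    omega
  have heC : e < C :=
    have p : Vset r × Fin s := (⟨v₀, hv₀⟩, ⟨0, hs⟩)
    (hg' p).1.trans (hCg p).le
  have hne (u v : V) (hu : u ∈ Vset r) (huv : G.Adj u v) :
      vertexSum H (extendLabel f g) (Sum.inl u) ≠ vertexSum H (extendLabel f g) (Sum.inl v) := by
    by_cases hv : v ∈ Vset r
    · exact absurd ((hcr u hu).trans (hcr v hv).symm) (hadj huv)
    · obtain ⟨i, hi, h⟩ := hother v hv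
      have := hci i (Finset.mem_of_mem_erase hi) (Finset.ne_of_mem_erase hi)
      rw [hC u hu, vertexSum_attachPendants_inl_notMem G f g hv, h]
      omega
  have hH : IsLocalAntimagic H (extendLabel f g) := by
    refine ⟨?_, ?_⟩
    · rw [card_edgeFinset_attachPendants, he]
      exact bijOn_extendLabel G (he ▸ setup.antimagic.1) hg
    · rintro (u | p) (v | q) huv
      · have huv' : G.Adj u v := (attachPendants_adj_inl_inl G _ s u v).1 huv
        by_cases hu : u ∈ Vset r
        · exact hne u v hu huv'
        · by_cases hv : v ∈ Vset r
          · exact (hne v u hv huv'.symm).symm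
          · rw [vertexSum_attachPendants_inl_notMem G f g hu,
              vertexSum_attachPendants_inl_notMem G f g hv]
            exact hadj huv'
      · rw [(attachPendants_adj_inl_inr G _ s u q).1 huv, hC _ q.1.2,
          vertexSum_attachPendants_inr]
        exact (hCg q).ne'
      · rw [(attachPendants_adj_inr_inl G _ s v p).1 huv, hC _ p.1.2,
          vertexSum_attachPendants_inr]
        exact (hCg p).ne
      · exact absurd huv (not_attachPendants_adj_inr_inr G _ s p q)
  have hupper : colorCount H (extendLabel f g) ≤ s * (Vset r).card + k + 1 := by
    have hsub : Finset.univ.image (vertexSum H (extendLabel f g)) ⊆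
        insert C (Finset.Icc (e + 1) (e + s * (Vset r).card) ∪
          ((Finset.Icc 1 t).erase r).image c) := by
      intro m hm
      obtain ⟨x, -, rfl⟩ := Finset.mem_image.1 hm
      rcases x with v | p
      · by_cases hv : v ∈ Vset r
        · rw [hC v hv]
          exact Finset.mem_insert_self _ _
        · rw [vertexSum_attachPendants_inl_notMem G f g hv]
          obtain ⟨i, hi, h⟩ := hother v hv
          exact Finset.mem_insert_of_mem
            (Finset.mem_union_right _ (h ▸ Finset.mem_image_of_mem c hi))
      · rw [vertexSum_attachPendants_inr]
        exact Finset.mem_insert_of_mem (Finset.mem_union_left _ (Finset.mem_Icc.2 (hg' p)))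
    have h1 := Finset.card_le_card hsub
    have h2 := Finset.card_insert_le C (Finset.Icc (e + 1) (e + s * (Vset r).card) ∪
          ((Finset.Icc 1 t).erase r).image c)
    have h3 := Finset.card_union_le (Finset.Icc (e + 1) (e + s * (Vset r).card))
      (((Finset.Icc 1 t).erase r).image c)
    have h4 := Finset.card_image_le (s := (Finset.Icc 1 t).erase r) (f := c)
    rw [Finset.card_erase_of_mem hr, Nat.card_Icc] at h4
    rw [Nat.card_Icc] at h3
    unfold colorCount
    omega
  have hlower {f'} (hf' : IsLocalAntimagic H f') : s * (Vset r).card + k + 1 ≤ colorCount H f' := by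
    rw [← hpc]
    refine pendantCount_lt_colorCount hf' ?_
    rw [card_edgeFinset_attachPendants]
    have := setup.two_le_card_edges
    omega
  have hchi : chiLA H ≤ colorCount H (extendLabel f g) := Nat.sInf_le ⟨_, hH, rfl⟩
  refine le_antisymm (hchi.trans hupper) ?_
  exact le_csInf ⟨_, _, hH, rfl⟩ fun n ⟨f', hf', h⟩ => h ▸ hlower hf'

end LocalAntimagic
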